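/- Fix a field k, an integer n ≥ 1 and a dimension vector d ∈ (Z≥0)^{Z/n}. Then there are only finitely many isomorphism classes of nilpotent representations of the cyclic quiver on n vertices over k with dimension vector d. (Indeed, every nilpotent representation is isomorphic to a finite direct sum of the representations E(i,l), and only finitely many such direct sums have dimension vector d.) -/

import Mathlib

/-!
STATEMENT 11: For a fixed field `k`, `n ≥ 1` and a dimension vector `d`, there are only
finitely many isomorphism classes of nilpotent representations of the cyclic quiver on
`n` vertices over `k` with dimension vector `d`.
-/

open Module

/-- transport along an equality of vertices -/
def vcast (k : Type*) [Field k] {n : ℕ} {V : ZMod n → Type*}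
    [∀ i, AddCommGroup (V i)] [∀ i, Module k (V i)]
    {i j : ZMod n} (h : i = j) : V i →ₗ[k] V j := by
  subst h; exact LinearMap.id

/-- the composition of `m` consecutive structure maps `V_i → V_{i+m}` -/
def rhoPow {k : Type*} [Field k] {n : ℕ} {V : ZMod n → Type*}
    [∀ i, AddCommGroup (V i)] [∀ i, Module k (V i)]
    (ρ : ∀ i : ZMod n, V i →ₗ[k] V (i + 1)) :
    (m : ℕ) → (i : ZMod n) → (V i →ₗ[k] V (i + (m : ZMod n)))
  | 0, i => vcast k (by simp)
  | (m + 1), i => vcast k (by push_cast; ring) ∘ₗ ((ρ (i + (m : ZMod n))) ∘ₗ rhoPow ρ m i)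

/-- A representation of the cyclic quiver on `n` vertices over `k`:
finite-dimensional vector spaces `V i` for `i : ℤ/n` and linear maps
`ρ i : V i → V (i+1)`. -/
structure CyclicRep (k : Type) [Field k] (n : ℕ) : Type 1 where
  V : ZMod n → Type
  [acg : ∀ i, AddCommGroup (V i)]
  [mod : ∀ i, Module k (V i)]
  [fd : ∀ i, FiniteDimensional k (V i)]
  rho : ∀ i : ZMod n, V i →ₗ[k] V (i + 1)

attribute [instance] CyclicRep.acg CyclicRep.mod CyclicRep.fd

/-- isomorphism of representations of the cyclic quiver: a `ℤ/n`-graded linear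
isomorphism intertwining the structure maps -/
def CyclicRep.Iso {k : Type} [Field k] {n : ℕ} (R S : CyclicRep k n) : Prop :=
  ∃ e : ∀ i : ZMod n, R.V i ≃ₗ[k] S.V i,
    ∀ (i : ZMod n) (x : R.V i), e (i + 1) (R.rho i x) = S.rho i (e i x)

/-- nilpotency: some `m`-fold composition of consecutive structure maps vanishes -/
def CyclicRep.IsNilpotent {k : Type} [Field k] {n : ℕ} (R : CyclicRep k n) : Prop :=
  ∃ m : ℕ, ∀ i : ZMod n, rhoPow R.rho m i = 0

/-- the setoid of nilpotent representations with dimension vector `d`, up to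
isomorphism -/
def nilpRepSetoid (k : Type) [Field k] (n : ℕ) (d : ZMod n → ℕ) :
    Setoid {R : CyclicRep k n //
      R.IsNilpotent ∧ ∀ i : ZMod n, finrank k (R.V i) = d i} where
  r R S := R.1.Iso S.1
  iseqv := by
    constructor
    · intro R
      exact ⟨fun i => LinearEquiv.refl k _, fun i x => rfl⟩
    · rintro R S ⟨e, he⟩
      refine ⟨fun i => (e i).symm, fun i x => ?_⟩
      apply (e (i + 1)).injective
      simp [he]
    · rintro R S T ⟨e, he⟩ ⟨f, hf⟩
      exact ⟨fun i => (e i).trans (f i), fun i x => by simp [he, hf]⟩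

section MonomialBases

variable {k : Type*} [Field k] {n : ℕ} {V : ZMod n → Type*}
  [∀ i, AddCommGroup (V i)] [∀ i, Module k (V i)]

theorem vcast_vcast {i j : ZMod n} (h : i = j) (h' : j = i) (v : V i) :
    vcast k h' (vcast k h v) = v := by
  subst h
  rfl

/-- the image of a graded subspace under the structure maps -/
def gradedImage (ρ : ∀ i : ZMod n, V i →ₗ[k] V (i + 1))
    (F : ∀ i, Submodule k (V i)) (j : ZMod n) : Submodule k (V j) :=
  ⨆ (i : ZMod n) (h : i + 1 = j), (F i).map (vcast k h ∘ₗ ρ i)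

theorem gradedImage_succ (ρ : ∀ i : ZMod n, V i →ₗ[k] V (i + 1))
    (F : ∀ i, Submodule k (V i)) (i : ZMod n) :
    gradedImage ρ F (i + 1) = (F i).map (ρ i) := by
  apply le_antisymm
  · refine iSup₂_le fun l h => ?_
    obtain rfl : l = i := add_right_cancel h
    exact le_rfl
  · exact le_iSup₂_of_le (f := fun l (h : l + 1 = i + 1) => (F l).map (vcast k h ∘ₗ ρ l))
      i rfl le_rfl

theorem gradedImage_mono (ρ : ∀ i : ZMod n, V i →ₗ[k] V (i + 1))
    {F G : ∀ i, Submodule k (V i)} (h : F ≤ G) : gradedImage ρ F ≤ gradedImage ρ G :=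
  fun _ => iSup₂_mono fun i _ => Submodule.map_mono (h i)

/-- the graded subspace of images of `m`-fold compositions of structure maps -/
def iterImage (ρ : ∀ i : ZMod n, V i →ₗ[k] V (i + 1)) :
    ℕ → ∀ i, Submodule k (V i)
  | 0 => ⊤
  | m + 1 => gradedImage ρ (iterImage ρ m)

theorem iterImage_succ_le (ρ : ∀ i : ZMod n, V i →ₗ[k] V (i + 1)) (m : ℕ) :
    iterImage ρ (m + 1) ≤ iterImage ρ m := by
  induction m with
  | zero => exact le_top
  | succ m ih => exact gradedImage_mono ρ ih

theorem iterImage_le_range_rhoPow (ρ : ∀ i : ZMod n, V i →ₗ[k] V (i + 1)) (m : ℕ)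
    (i j : ZMod n) (h : i + (m : ZMod n) = j) :
    iterImage ρ m j ≤ LinearMap.range (vcast k h ∘ₗ rhoPow ρ m i) := by
  induction m generalizing j with
  | zero =>
    obtain rfl : i = j := by simpa using h
    intro y _
    exact ⟨y, vcast_vcast _ _ _⟩
  | succ m ih =>
    have h' : (i + (m : ZMod n)) + 1 = j := by rw [← h]; push_cast; ring
    subst h'
    rw [iterImage, gradedImage_succ]
    rintro _ ⟨y, hy, rfl⟩
    obtain ⟨x, rfl⟩ := ih _ rfl hy
    exact ⟨x, vcast_vcast _ _ _⟩

/-- A homogeneous basis of the graded subspace `F` whose elements are sent to zero or to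
basis elements by the structure maps. -/
structure IsMonomialBasis (ρ : ∀ i : ZMod n, V i →ₗ[k] V (i + 1))
    (F : ∀ i, Submodule k (V i)) (B : ∀ i, Set (V i)) : Prop where
  linearIndepOn : ∀ i, LinearIndepOn k id (B i)
  span_eq : ∀ i, Submodule.span k (B i) = F i
  map_mem : ∀ i, ∀ x ∈ B i, ρ i x ∈ insert 0 (B (i + 1))

theorem IsMonomialBasis.exists_of_gradedImage {ρ : ∀ i : ZMod n, V i →ₗ[k] V (i + 1)}
    {F : ∀ i, Submodule k (V i)} (hF : gradedImage ρ F ≤ F) {B : ∀ i, Set (V i)}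
    (hB : IsMonomialBasis ρ (gradedImage ρ F) B) : ∃ C, IsMonomialBasis ρ F C := by
  let T : ∀ i, Set (V i) := fun i => {x | x ∈ F i ∧ ρ i x ∈ insert 0 (B (i + 1))}
  have hBT : ∀ i, B i ⊆ T i := fun i x hx =>
    ⟨hF i (hB.span_eq i ▸ Submodule.subset_span hx), hB.map_mem i x hx⟩
  have hT : ∀ i, Submodule.span k (T i) = F i := by
    intro i
    apply le_antisymm (Submodule.span_le.2 fun x hx => hx.1)
    intro x hx
    have hmap : B (i + 1) ⊆ (Submodule.span k (T i)).map (ρ i) := by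
      intro b hb
      have hb' : b ∈ (F i).map (ρ i) := by
        rw [← gradedImage_succ, ← hB.span_eq]
        exact Submodule.subset_span hb
      obtain ⟨y, hy, rfl⟩ := hb'
      exact ⟨y, Submodule.subset_span ⟨hy, Or.inr hb⟩, rfl⟩
    have hx' : ρ i x ∈ (Submodule.span k (T i)).map (ρ i) := by
      refine Submodule.span_le.2 hmap ?_
      rw [hB.span_eq, gradedImage_succ]
      exact ⟨x, hx, rfl⟩
    obtain ⟨y, hy, hyx⟩ := hx'
    have hyF : y ∈ F i := Submodule.span_le.2 (fun z hz => hz.1) hy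
    have hd : x - y ∈ Submodule.span k (T i) :=
      Submodule.subset_span ⟨sub_mem hx hyF, Or.inl (by rw [map_sub, hyx, sub_self])⟩
    simpa using add_mem hd hy
  choose C hCT hBC hTC hC using fun i =>
    exists_linearIndepOn_id_extension (hB.linearIndepOn i) (hBT i)
  refine ⟨C, hC, fun i => ?_, fun i x hx => ?_⟩
  · rw [← hT i]
    exact le_antisymm (Submodule.span_mono (hCT i)) (Submodule.span_le.2 (hTC i))
  · exact Set.insert_subset_insert (hBC (i + 1)) (hCT i hx).2

theorem exists_isMonomialBasis_top (ρ : ∀ i : ZMod n, V i →ₗ[k] V (i + 1)) {m : ℕ}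
    (hm : ∀ i, rhoPow ρ m i = 0) : ∃ B, IsMonomialBasis ρ ⊤ B := by
  have hbot : ∀ j, iterImage ρ m j = ⊥ := by
    intro j
    have h := iterImage_le_range_rhoPow ρ m (j - m) j (by ring)
    rw [hm, LinearMap.comp_zero, LinearMap.range_zero] at h
    exact le_bot_iff.1 h
  suffices h : ∀ l ≤ m, ∃ B, IsMonomialBasis ρ (iterImage ρ l) B from h 0 m.zero_le
  intro l hl
  induction hl using Nat.decreasingInduction with
  | self =>
    exact ⟨fun _ => ∅, fun _ => linearIndepOn_empty k id,
      fun i => by rw [Submodule.span_empty, hbot], fun _ _ hx => hx.elim⟩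
  | of_succ l _ ih =>
    obtain ⟨B, hB⟩ := ih
    exact hB.exists_of_gradedImage (iterImage_succ_le ρ l)

end MonomialBases

namespace CyclicRep

variable {k : Type} [Field k] {n : ℕ} {d : ZMod n → ℕ}

/-- `R` has bases on which its structure maps act by the partial maps `f`. -/
def HasShape (R : CyclicRep k n) (f : ∀ i, Fin (d i) → Option (Fin (d (i + 1)))) : Prop :=
  ∃ b : ∀ i, Basis (Fin (d i)) k (R.V i),
    ∀ i j, R.rho i (b i j) = (f i j).elim 0 (b (i + 1))

theorem HasShape.iso {R S : CyclicRep k n} {f : ∀ i, Fin (d i) → Option (Fin (d (i + 1)))}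
    (hR : R.HasShape f) (hS : S.HasShape f) : R.Iso S := by
  obtain ⟨b, hb⟩ := hR
  obtain ⟨c, hc⟩ := hS
  refine ⟨fun i => (b i).equiv (c i) (Equiv.refl _), fun i x => ?_⟩
  have h : ((b (i + 1)).equiv (c (i + 1)) (Equiv.refl _)).toLinearMap ∘ₗ R.rho i =
      S.rho i ∘ₗ ((b i).equiv (c i) (Equiv.refl _)).toLinearMap := by
    refine (b i).ext fun j => ?_
    cases hf : f i j <;> simp [hb, hc, hf]
  exact LinearMap.congr_fun h x

theorem IsNilpotent.exists_hasShape {R : CyclicRep k n} (hR : R.IsNilpotent)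
    (hd : ∀ i, finrank k (R.V i) = d i) :
    ∃ f : ∀ i, Fin (d i) → Option (Fin (d (i + 1))), R.HasShape f := by
  obtain ⟨m, hm⟩ := hR
  obtain ⟨B, hB⟩ := exists_isMonomialBasis_top R.rho hm
  have hbasis : ∀ i, ∃ b : Basis (Fin (d i)) k (R.V i), Set.range b = B i := by
    intro i
    let b₀ : Basis (B i) k (R.V i) := Basis.mk (v := fun x : B i => (x : R.V i))
      (hB.linearIndepOn i) (by rw [Subtype.range_coe, hB.span_eq]; exact le_rfl)
    have : Finite (B i) := Module.Finite.finite_basis b₀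
    have hcard : Nat.card (B i) = d i := by rw [← hd i, finrank_eq_nat_card_basis b₀]
    refine ⟨b₀.reindex (Finite.equivFinOfCardEq hcard), ?_⟩
    rw [Basis.range_reindex, show ⇑b₀ = fun x : B i => (x : R.V i) from Basis.coe_mk _ _,
      Subtype.range_coe]
  choose b hb using hbasis
  have hf : ∀ i j, ∃ o : Option (Fin (d (i + 1))),
      R.rho i (b i j) = o.elim 0 (b (i + 1)) := by
    intro i j
    rcases hB.map_mem i (b i j) (hb i ▸ Set.mem_range_self j) with h | h
    · exact ⟨none, h⟩
    · rw [← hb] at h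
      obtain ⟨l, hl⟩ := h
      exact ⟨some l, hl.symm⟩
  choose f hf using hf
  exact ⟨f, b, hf⟩

end CyclicRep

/-- There are only finitely many isomorphism classes of nilpotent representations of
the cyclic quiver on `n` vertices over `k` with a fixed dimension vector `d`. -/
theorem finitely_many_nilpotent_reps (k : Type) [Field k] (n : ℕ) [NeZero n]
    (d : ZMod n → ℕ) : Finite (Quotient (nilpRepSetoid k n d)) := by
  choose f hf using fun R : {R : CyclicRep k n //
      R.IsNilpotent ∧ ∀ i : ZMod n, finrank k (R.V i) = d i} =>
    R.2.1.exists_hasShape R.2.2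
  refine Finite.of_injective (fun q => f q.out) fun p q hpq => ?_
  have hpq' : f p.out = f q.out := hpq
  rw [← p.out_eq, ← q.out_eq]
  exact Quotient.sound ((hf p.out).iso (hpq' ▸ hf q.out))
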